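/- Let M > 0 and let (f_n) be a sequence of continuous real-valued functions on [0,1] such that (1/M)·‖(λ_1,…,λ_n,0,…)‖_J ≤ ‖λ_1 f_1 + ⋯ + λ_n f_n‖_∞ ≤ M·‖(λ_1,…,λ_n,0,…)‖_J for every n and all reals λ_1, …, λ_n. Define g_n(a,b) = f_n(a)·max(0, 1 − 2ⁿ b) on K = [0,1]². Then there is no isomorphic embedding of c₀ into the closed linear span of { g_n : n ∈ ℕ } in C(K); that is, no continuous linear injection from c₀ into that closed linear span is bounded below. -/

import Mathlib

open unitInterval ZeroAtInfty

/-- The James norm of a sequence `x = (x₀, x₁, x₂, …)` of real numbers (the sequence is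
indexed starting at `0`, corresponding to the paper's `x₁, x₂, …`):
`‖x‖_J = sup { √(x_{p 0}² + (x_{p 1} − x_{p 0})² + ⋯ + (x_{p k} − x_{p (k−1)})²) :
  k ∈ ℕ, p : ℕ → ℕ strictly increasing }`. -/
noncomputable def jamesNorm (x : ℕ → ℝ) : ℝ :=
  sSup {r : ℝ | ∃ (k : ℕ) (p : ℕ → ℕ), StrictMono p ∧
    r = Real.sqrt ((x (p 0)) ^ 2 + ∑ i ∈ Finset.range k, (x (p (i + 1)) - x (p i)) ^ 2)}

/-- `g_n ∈ C(K)`, `K = [0,1]²`, given by `g_n(a,b) = f_n(a) · max(0, 1 − 2ⁿ b)`. -/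
noncomputable def gMap (f : ℕ → C(I, ℝ)) (n : ℕ) : C(I × I, ℝ) :=
  ⟨fun p => f n p.1 * max 0 (1 - 2 ^ n * (p.2 : ℝ)), by fun_prop⟩

/-- The squared variation of `x` along the points `p 0, …, p k`, started from the value `0`. -/
noncomputable def jamesVariation (x : ℕ → ℝ) (k : ℕ) (p : ℕ → ℕ) : ℝ :=
  x (p 0) ^ 2 + ∑ i ∈ Finset.range k, (x (p (i + 1)) - x (p i)) ^ 2

lemma jamesVariation_nonneg (x : ℕ → ℝ) (k : ℕ) (p : ℕ → ℕ) : 0 ≤ jamesVariation x k p := by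
  unfold jamesVariation; positivity

lemma exists_strictMono_jamesVariation_eq (x : ℕ → ℝ) {p : ℕ → ℕ} (hp : Monotone p) (k : ℕ) :
    ∃ (m : ℕ) (q : ℕ → ℕ), StrictMono q ∧ q m = p k ∧
      jamesVariation x m q = jamesVariation x k p := by
  induction k with
  | zero => exact ⟨0, fun i => p 0 + i, fun i j h => by simpa using h, by simp,
      by simp [jamesVariation]⟩
  | succ k ih =>
    obtain ⟨m, q, hq, hqm, hv⟩ := ih
    rcases (hp (Nat.le_succ k)).eq_or_lt with h | h
    · refine ⟨m, q, hq, hqm.trans h, hv.trans ?_⟩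
      simp only [Nat.succ_eq_add_one] at h
      simp [jamesVariation, Finset.sum_range_succ, h]
    · refine ⟨m + 1, fun i => if i ≤ m then q i else p (k + 1) + (i - (m + 1)), ?_, by simp, ?_⟩
      · refine strictMono_nat_of_lt_succ fun i => ?_
        rcases lt_trichotomy i m with hi | rfl | hi
        · simpa [hi.le, Nat.succ_le_of_lt hi] using hq (Nat.lt_succ_self i)
        · simpa [hqm] using h
        · simp only [show ¬ i ≤ m by omega, show ¬ i + 1 ≤ m by omega, if_false]
          omega
      · have h₁ : ∀ i ∈ Finset.range m,
            (x (if i + 1 ≤ m then q (i + 1) else p (k + 1) + (i + 1 - (m + 1))) -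
              x (if i ≤ m then q i else p (k + 1) + (i - (m + 1)))) ^ 2 =
            (x (q (i + 1)) - x (q i)) ^ 2 := by
          intro i hi
          have := Finset.mem_range.1 hi
          rw [if_pos (by omega), if_pos (by omega)]
        unfold jamesVariation at hv ⊢
        rw [Finset.sum_range_succ, Finset.sum_range_succ, Finset.sum_congr rfl h₁,
          ← add_assoc, ← add_assoc, ← hv]
        simp [hqm]

lemma jamesVariation_le_sum (x : ℕ →₀ ℝ) {p : ℕ → ℕ} (hp : StrictMono p) (k : ℕ) :
    jamesVariation x k p ≤ 5 * ∑ j ∈ x.support, x j ^ 2 := by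
  have key : ∀ (m : ℕ) (q : ℕ → ℕ), StrictMono q →
      ∑ i ∈ Finset.range m, x (q i) ^ 2 ≤ ∑ j ∈ x.support, x j ^ 2 := by
    intro m q hq
    rw [← Finset.sum_image (f := fun j => x j ^ 2) (hq.injective.injOn)]
    rw [← Finset.sum_filter_ne_zero]
    refine Finset.sum_le_sum_of_subset_of_nonneg (fun j hj => ?_) fun _ _ _ => sq_nonneg _
    simpa using (Finset.mem_filter.1 hj).2
  have h₁ := key 1 p hp
  have h₂ := key k p hp
  have h₃ := key k (fun i => p (i + 1)) fun i j h => hp (by simpa using h)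
  have h₄ : ∑ i ∈ Finset.range k, (x (p (i + 1)) - x (p i)) ^ 2 ≤
      ∑ i ∈ Finset.range k, (2 * x (p (i + 1)) ^ 2 + 2 * x (p i) ^ 2) :=
    Finset.sum_le_sum fun i _ => by nlinarith [sq_nonneg (x (p (i + 1)) + x (p i))]
  rw [Finset.sum_add_distrib, ← Finset.mul_sum, ← Finset.mul_sum] at h₄
  simp only [Finset.sum_range_one] at h₁
  unfold jamesVariation
  linarith

lemma jamesNorm_nonneg (x : ℕ → ℝ) : 0 ≤ jamesNorm x := by
  refine Real.sSup_nonneg ?_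
  rintro r ⟨k, p, -, rfl⟩
  exact Real.sqrt_nonneg _

lemma jamesVariation_le_jamesNorm_sq (x : ℕ →₀ ℝ) {p : ℕ → ℕ} (hp : Monotone p) (k : ℕ) :
    jamesVariation x k p ≤ jamesNorm x ^ 2 := by
  obtain ⟨m, q, hq, -, hv⟩ := exists_strictMono_jamesVariation_eq x hp k
  rw [← hv]
  refine (Real.sqrt_le_left (jamesNorm_nonneg _)).1 (le_csSup ?_ ⟨m, q, hq, rfl⟩)
  refine ⟨√(5 * ∑ j ∈ x.support, x j ^ 2), ?_⟩
  rintro r ⟨k, p, hp, rfl⟩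
  exact Real.sqrt_le_sqrt (jamesVariation_le_sum x hp k)

lemma jamesNorm_sq_le {x : ℕ → ℝ} {B : ℝ}
    (h : ∀ k p, StrictMono p → jamesVariation x k p ≤ B) : jamesNorm x ^ 2 ≤ B := by
  have hB : 0 ≤ B := (jamesVariation_nonneg x 0 id).trans (h 0 id strictMono_id)
  refine (Real.le_sqrt (jamesNorm_nonneg x) hB).1 (csSup_le ⟨_, 0, id, strictMono_id, rfl⟩ ?_)
  rintro r ⟨k, p, hp, rfl⟩
  exact Real.sqrt_le_sqrt (h k p hp)

lemma abs_apply_le_jamesNorm (x : ℕ →₀ ℝ) (j : ℕ) : |x j| ≤ jamesNorm x := by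
  refine abs_le_of_sq_le_sq ?_ (jamesNorm_nonneg _)
  simpa [jamesVariation] using
    jamesVariation_le_jamesNorm_sq x (p := fun _ => j) monotone_const 0

/-- The unit vectors form a monotone basis for the James norm. -/
lemma jamesNorm_filter_lt_le (x : ℕ →₀ ℝ) (m : ℕ) :
    jamesNorm (x.filter (· < m)) ≤ jamesNorm x := by
  refine (sq_le_sq₀ (jamesNorm_nonneg _) (jamesNorm_nonneg _)).1 (jamesNorm_sq_le fun k p hp => ?_)
  obtain ⟨n, hn⟩ := x.support.exists_nat_subset_range
  have hx : x (max m n) = 0 := by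
    by_contra h
    have := Finset.mem_range.1 (hn (Finsupp.mem_support_iff.2 h))
    omega
  let q : ℕ → ℕ := fun i => if p i < m then p i else max m n
  have hq : Monotone q := by
    intro i j hij
    have := hp.monotone hij
    simp only [q]
    split_ifs <;> omega
  have hxq : ∀ i, x.filter (· < m) (p i) = x (q i) := by
    intro i
    by_cases h : p i < m <;> simp [q, h, hx]
  have := jamesVariation_le_jamesNorm_sq x hq k
  simpa only [jamesVariation, hxq] using this

/-- Vectors separated by a gap satisfy a lower `ℓ₂` estimate for the James norm. -/
lemma jamesNorm_sq_add_le (x y : ℕ →₀ ℝ) (L : ℕ) (hx : ∀ j, L ≤ j → x j = 0)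
    (hy : ∀ j ≤ L, y j = 0) :
    jamesNorm x ^ 2 + jamesNorm y ^ 2 ≤ jamesNorm (x + y : ℕ →₀ ℝ) ^ 2 := by
  suffices h : ∀ k p, StrictMono p → ∀ m q, StrictMono q →
      jamesVariation x k p + jamesVariation y m q ≤ jamesNorm (x + y : ℕ →₀ ℝ) ^ 2 by
    rw [← le_sub_iff_add_le]
    refine jamesNorm_sq_le fun k p hp => ?_
    rw [le_sub_comm]
    refine jamesNorm_sq_le fun m q hq => ?_
    have := h k p hp m q hq
    linarith
  intro k p hp m q hq
  let r : ℕ → ℕ := fun i => if i ≤ k then min (p i) L else if i = k + 1 then L else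
    max (q (i - (k + 2))) L
  have hr : Monotone r := by
    refine monotone_nat_of_le_succ fun i => ?_
    have h₁ := hp.monotone (Nat.le_succ i)
    have h₂ : q (i - (k + 2)) ≤ q (i + 1 - (k + 2)) := hq.monotone (by omega)
    simp only [r, Nat.succ_eq_add_one] at h₁ ⊢
    split_ifs <;> omega
  have hmin : ∀ j, (x + y) (min j L) = x j := by
    intro j
    rcases le_total j L with h | h
    · simp [h, hy j h]
    · simp [h, hx j h, hx L le_rfl, hy L le_rfl]
  have hmax : ∀ j, (x + y) (max j L) = y j := by
    intro j
    rcases le_total j L with h | h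
    · simp [h, hy j h, hx L le_rfl, hy L le_rfl]
    · simp [h, hx j h]
  have hr₁ : ∀ i ≤ k, (x + y) (r i) = x (p i) := by
    intro i hi
    simp only [r, if_pos hi, hmin]
  have hr₂ : (x + y) (r (k + 1)) = 0 := by simp [r, hx L le_rfl, hy L le_rfl]
  have hr₃ : ∀ i, (x + y) (r (k + 2 + i)) = y (q i) := by
    intro i
    simp only [r, show ¬ k + 2 + i ≤ k by omega, show ¬ k + 2 + i = k + 1 by omega, if_false,
      Nat.add_sub_cancel_left, hmax]
  refine le_trans ?_ (jamesVariation_le_jamesNorm_sq (x + y) hr (k + 2 + m))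
  unfold jamesVariation
  rw [Finset.sum_range_add, Finset.sum_range_succ, Finset.sum_range_succ, hr₁ 0 (Nat.zero_le k),
    hr₂, hr₁ k le_rfl, show k + 1 + 1 = k + 2 + 0 from rfl, hr₃ 0]
  have h₁ : ∑ i ∈ Finset.range k, ((x + y) (r (i + 1)) - (x + y) (r i)) ^ 2 =
      ∑ i ∈ Finset.range k, (x (p (i + 1)) - x (p i)) ^ 2 := by
    refine Finset.sum_congr rfl fun i hi => ?_
    have := Finset.mem_range.1 hi
    rw [hr₁ _ (by omega), hr₁ _ (by omega)]
  have h₂ : ∑ i ∈ Finset.range m, ((x + y) (r (k + 2 + i + 1)) - (x + y) (r (k + 2 + i))) ^ 2 =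
      ∑ i ∈ Finset.range m, (y (q (i + 1)) - y (q i)) ^ 2 := by
    refine Finset.sum_congr rfl fun i _ => ?_
    rw [add_assoc (k + 2) i 1, hr₃, hr₃]
  rw [h₁, h₂]
  nlinarith [sq_nonneg (0 - x (p k))]

section JamesEmbedding

variable {E : Type*} [NormedAddCommGroup E] [NormedSpace ℝ E]

open Filter Topology

/-- If the coordinates of `u k` tend to `0` as `k → ∞` and the vectors `G (u k)` are bounded away
from `0`, a gliding hump produces sums of the `u k` of large James norm. -/
lemma exists_large_jamesNorm (G : (ℕ →₀ ℝ) →ₗ[ℝ] E) {M : ℝ} (hM : 0 < M)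
    (hup : ∀ x : ℕ →₀ ℝ, ‖G x‖ ≤ M * jamesNorm x) (u : ℕ → ℕ →₀ ℝ)
    (hu : ∀ j, Tendsto (fun k => u k j) atTop (𝓝 0)) {c : ℝ} (hc : 0 < c)
    (huc : ∀ k, c ≤ ‖G (u k)‖) (N : ℕ) :
    ∀ ε > 0, ∃ (z : ℕ →₀ ℝ) (S : Finset ℕ), N * (c / (2 * M)) ^ 2 ≤ jamesNorm z ^ 2 ∧
      ‖G z - ∑ k ∈ S, G (u k)‖ ≤ ε := by
  induction N with
  | zero => exact fun ε hε => ⟨0, ∅, by simpa using sq_nonneg _, by simpa using hε.le⟩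
  | succ N ih =>
    intro ε hε
    obtain ⟨z, S, hz, hzS⟩ := ih (ε / 2) (by linarith)
    obtain ⟨L, hL⟩ := z.support.exists_nat_subset_range
    have hlim : Tendsto (fun k => G ((u k).filter (· < L + 1))) atTop (𝓝 0) := by
      have : ∀ k, G ((u k).filter (· < L + 1)) =
          ∑ j ∈ Finset.range (L + 1), u k j • G (Finsupp.single j 1) := by
        intro k
        rw [show (u k).filter (· < L + 1) =
          ∑ j ∈ Finset.range (L + 1), u k j • Finsupp.single j (1 : ℝ) from ?_, map_sum]
        · simp only [map_smul]
        · ext i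
          simp [Finsupp.filter_apply, Finsupp.finsetSum_apply, Finsupp.single_apply]
      simp only [this]
      simpa using tendsto_finsetSum (Finset.range (L + 1)) fun j _ =>
        (hu j).smul_const (G (Finsupp.single j 1))
    have hδ : 0 < min (ε / 2) (c / 2) := by positivity
    obtain ⟨K, hK⟩ := S.exists_nat_subset_range
    obtain ⟨k, hk, hkK⟩ :=
      ((hlim.norm.eventually_lt_const (norm_zero.trans_lt hδ)).and (eventually_ge_atTop K)).exists
    have hkS : k ∉ S := fun h => by
      have := Finset.mem_range.1 (hK h)
      omega
    set w := (u k).filter (· < L + 1) with hw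
    have hjn : c / (2 * M) ≤ jamesNorm (u k - w : ℕ →₀ ℝ) := by
      have h₁ := hup (u k - w)
      have h₂ := norm_sub_norm_le (G (u k)) (G w)
      rw [map_sub] at h₁
      rw [div_le_iff₀ (by positivity)]
      linarith [huc k, min_le_right (ε / 2) (c / 2)]
    refine ⟨z + (u k - w), insert k S, ?_, ?_⟩
    · refine le_trans ?_ (jamesNorm_sq_add_le z (u k - w) L (fun j hj => ?_) fun j hj => ?_)
      · have := pow_le_pow_left₀ (by positivity) hjn 2
        rw [Nat.cast_succ, add_one_mul]
        exact add_le_add hz this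
      · by_contra h
        have := Finset.mem_range.1 (hL (Finsupp.mem_support_iff.2 h))
        omega
      · simp [hw, hj]
    · rw [Finset.sum_insert hkS, map_add, map_sub]
      calc ‖G z + (G (u k) - G w) - (G (u k) + ∑ k ∈ S, G (u k))‖
          = ‖(G z - ∑ k ∈ S, G (u k)) - G w‖ := by congr 1; abel
        _ ≤ ‖G z - ∑ k ∈ S, G (u k)‖ + ‖G w‖ := norm_sub_le _ _
        _ ≤ ε := by linarith [min_le_left (ε / 2) (c / 2)]

lemma not_bounded_signed_sums (G : (ℕ →₀ ℝ) →ₗ[ℝ] E) {M : ℝ} (hM : 0 < M)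
    (hlow : ∀ x : ℕ →₀ ℝ, jamesNorm x ≤ M * ‖G x‖)
    (hup : ∀ x : ℕ →₀ ℝ, ‖G x‖ ≤ M * jamesNorm x) (u : ℕ → ℕ →₀ ℝ) {c C : ℝ} (hc : 0 < c)
    (huc : ∀ k, c ≤ ‖G (u k)‖)
    (huC : ∀ (S : Finset ℕ) (s : ℕ → ℝ), (∀ k, |s k| ≤ 1) → ‖∑ k ∈ S, s k • G (u k)‖ ≤ C) :
    False := by
  have hu : ∀ j, Tendsto (fun k => u k j) atTop (𝓝 0) := by
    intro j
    have hsum : Summable fun k => |u k j| := by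
      refine summable_of_sum_le (c := M * C) (fun k => abs_nonneg _) fun S => ?_
      have h₁ := huC S (fun k => SignType.sign (u k j)) fun k => by
        rcases lt_trichotomy (u k j) 0 with h | h | h <;> simp [h]
      have h₂ := (abs_apply_le_jamesNorm (∑ k ∈ S, (SignType.sign (u k j) : ℝ) • u k) j).trans
        (hlow _)
      simp only [map_sum, map_smul, Finsupp.finsetSum_apply, Finsupp.smul_apply, smul_eq_mul,
        sign_mul_self] at h₂
      exact (le_abs_self _).trans (h₂.trans (mul_le_mul_of_nonneg_left h₁ hM.le))
    exact (tendsto_zero_iff_abs_tendsto_zero _).2 hsum.tendsto_atTop_zero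
  obtain ⟨N, hN⟩ := exists_nat_gt ((M * (C + 1)) ^ 2 / (c / (2 * M)) ^ 2)
  rw [div_lt_iff₀ (by positivity)] at hN
  obtain ⟨z, S, hz, hzS⟩ := exists_large_jamesNorm G hM hup u hu hc huc N 1 one_pos
  have h₁ : ‖G z‖ ≤ C + 1 := by
    have h := huC S (fun _ => 1) (by simp)
    simp only [one_smul] at h
    linarith [norm_sub_norm_le (G z) (∑ k ∈ S, G (u k))]
  have h₂ : jamesNorm z ≤ M * (C + 1) :=
    (hlow z).trans (mul_le_mul_of_nonneg_left h₁ hM.le)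
  have h₃ := pow_le_pow_left₀ (jamesNorm_nonneg z) h₂ 2
  linarith

/-- A space whose dense part carries a norm equivalent to the James norm contains no sequence
that is bounded away from `0` and has uniformly bounded signed sums. -/
lemma not_bounded_signed_sums_of_mem_closure (G : (ℕ →₀ ℝ) →ₗ[ℝ] E) {M : ℝ} (hM : 0 < M)
    (hlow : ∀ x : ℕ →₀ ℝ, jamesNorm x ≤ M * ‖G x‖)
    (hup : ∀ x : ℕ →₀ ℝ, ‖G x‖ ≤ M * jamesNorm x) (e : ℕ → E)
    (he : ∀ k, e k ∈ closure (Set.range G)) {c C : ℝ} (hc : 0 < c) (hec : ∀ k, c ≤ ‖e k‖)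
    (heC : ∀ (S : Finset ℕ) (s : ℕ → ℝ), (∀ k, |s k| ≤ 1) → ‖∑ k ∈ S, s k • e k‖ ≤ C) :
    False := by
  have happrox : ∀ k, ∃ u : ℕ →₀ ℝ, ‖e k - G u‖ < c / 4 * (1 / 2) ^ k := by
    intro k
    obtain ⟨_, ⟨u, rfl⟩, hu⟩ := Metric.mem_closure_iff.1 (he k) (c / 4 * (1 / 2) ^ k)
      (by positivity)
    exact ⟨u, by rwa [← dist_eq_norm]⟩
  choose u hu using happrox
  refine not_bounded_signed_sums G hM hlow hup u (c := c / 2) (C := C + c / 4 * 2)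
    (by positivity) (fun k => ?_) fun S s hs => ?_
  · have h₁ : c / 4 * (1 / 2) ^ k ≤ c / 4 :=
      mul_le_of_le_one_right (by positivity) (pow_le_one₀ (by norm_num) (by norm_num))
    linarith [norm_sub_norm_le (e k) (G (u k)), hu k, hec k]
  · have h₁ : ‖∑ k ∈ S, s k • (e k - G (u k))‖ ≤ c / 4 * 2 := by
      calc ‖∑ k ∈ S, s k • (e k - G (u k))‖ ≤ ∑ k ∈ S, c / 4 * (1 / 2) ^ k := by
            refine norm_sum_le_of_le S fun k _ => ?_
            rw [norm_smul, Real.norm_eq_abs]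
            exact (mul_le_of_le_one_left (norm_nonneg _) (hs k)).trans (hu k).le
        _ ≤ c / 4 * 2 := by
            rw [← Finset.mul_sum]
            refine mul_le_mul_of_nonneg_left ?_ (by positivity)
            exact sum_le_hasSum S (fun k _ => by positivity) hasSum_geometric_two
    have h₂ : ∑ k ∈ S, s k • G (u k) =
        ∑ k ∈ S, s k • e k - ∑ k ∈ S, s k • (e k - G (u k)) := by
      simp [smul_sub, Finset.sum_sub_distrib]
    rw [h₂]
    exact (norm_sub_le _ _).trans (add_le_add (heC S s hs) h₁)

end JamesEmbedding

/-- Abel summation bound: weights decreasing from at most `1` to `0` do not increase a uniform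
bound on partial sums. -/
lemma abs_sum_mul_le_of_antitone {a h : ℕ → ℝ} {B : ℝ} (hh : Antitone h) (h0 : ∀ n, 0 ≤ h n)
    (h1 : h 0 ≤ 1) (ha : ∀ n, |∑ i ∈ Finset.range n, a i| ≤ B) (n : ℕ) :
    |∑ i ∈ Finset.range n, h i * a i| ≤ B := by
  have hB : 0 ≤ B := (abs_nonneg _).trans (ha 0)
  have key : ∀ n, |∑ i ∈ Finset.range n, h i * a i - h n * ∑ i ∈ Finset.range n, a i| ≤
      B * (h 0 - h n) := by
    intro n
    induction n with
    | zero => simp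
    | succ n ih =>
      have hd : 0 ≤ h n - h (n + 1) := sub_nonneg.2 (hh (Nat.le_succ n))
      calc _ = |(∑ i ∈ Finset.range n, h i * a i - h n * ∑ i ∈ Finset.range n, a i) +
            (h n - h (n + 1)) * ∑ i ∈ Finset.range (n + 1), a i| := by
            congr 1; rw [Finset.sum_range_succ, Finset.sum_range_succ]; ring
        _ ≤ B * (h 0 - h n) + (h n - h (n + 1)) * B := by
            refine (abs_add_le _ _).trans (add_le_add ih ?_)
            rw [abs_mul, abs_of_nonneg hd]
            exact mul_le_mul_of_nonneg_left (ha _) hd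
        _ = _ := by ring
  calc _ = |(∑ i ∈ Finset.range n, h i * a i - h n * ∑ i ∈ Finset.range n, a i) +
        h n * ∑ i ∈ Finset.range n, a i| := by congr 1; ring
    _ ≤ B * (h 0 - h n) + h n * B := by
        refine (abs_add_le _ _).trans (add_le_add (key n) ?_)
        rw [abs_mul, abs_of_nonneg (h0 n)]
        exact mul_le_mul_of_nonneg_left (ha _) (h0 n)
    _ = B * h 0 := by ring
    _ ≤ B := mul_le_of_le_one_right hB h1

/-- The `k`-th unit vector of `c₀`. -/
noncomputable def c0Single (k : ℕ) : C₀(ℕ, ℝ) where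
  toFun := Pi.single k 1
  continuous_toFun := continuous_of_discreteTopology
  zero_at_infty' := by
    rw [Filter.cocompact_eq_cofinite]
    refine tendsto_const_nhds.congr' ?_
    filter_upwards [(Set.finite_singleton k).compl_mem_cofinite] with i hi
    exact (Pi.single_eq_of_ne (M := fun _ => ℝ) (by simpa using hi) _).symm

lemma c0Single_apply (k i : ℕ) : c0Single k i = if i = k then 1 else 0 := Pi.single_apply k 1 i

lemma norm_c0Single_ge (k : ℕ) : 1 ≤ ‖c0Single k‖ := by
  have := (c0Single k).toBCF.norm_coe_le_norm k
  rw [ZeroAtInftyContinuousMap.norm_toBCF_eq_norm] at this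
  simpa [c0Single_apply] using this

lemma norm_sum_smul_c0Single_le (S : Finset ℕ) (s : ℕ → ℝ) (hs : ∀ k, |s k| ≤ 1) :
    ‖∑ k ∈ S, s k • c0Single k‖ ≤ 1 := by
  rw [← ZeroAtInftyContinuousMap.norm_toBCF_eq_norm,
    BoundedContinuousFunction.norm_le zero_le_one]
  intro i
  change ‖(∑ k ∈ S, s k • c0Single k) i‖ ≤ 1
  have : (∑ k ∈ S, s k • c0Single k) i = if i ∈ S then s i else 0 := by
    have h : (∑ k ∈ S, s k • c0Single k) i = ∑ k ∈ S, s k * c0Single k i := by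
      induction S using Finset.induction_on with
      | empty => rfl
      | insert a S ha ih => rw [Finset.sum_insert ha, Finset.sum_insert ha, ← ih]; rfl
    rw [h]
    simp [c0Single_apply]
  rw [this]
  split_ifs
  · exact hs i
  · simp

lemma linearCombination_eq_sum_range {E : Type*} [AddCommGroup E] [Module ℝ E] (v : ℕ → E)
    (x : ℕ →₀ ℝ) {n : ℕ} (hn : x.support ⊆ Finset.range n) :
    Finsupp.linearCombination ℝ v x = ∑ i ∈ Finset.range n, x i • v i := by
  rw [Finsupp.linearCombination_apply]
  exact Finsupp.sum_of_support_subset x hn _ (by simp)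

lemma jamesNorm_equiv_linearCombination {M : ℝ} {f : ℕ → C(I, ℝ)}
    (hf : ∀ (n : ℕ) (lam : ℕ → ℝ),
      (1 / M) * jamesNorm (fun j => if j < n then lam (j + 1) else 0) ≤
        ‖∑ i ∈ Finset.Icc 1 n, lam i • f i‖ ∧
      ‖∑ i ∈ Finset.Icc 1 n, lam i • f i‖ ≤
        M * jamesNorm (fun j => if j < n then lam (j + 1) else 0)) (x : ℕ →₀ ℝ) :
    (1 / M) * jamesNorm x ≤ ‖Finsupp.linearCombination ℝ (fun n => f (n + 1)) x‖ ∧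
      ‖Finsupp.linearCombination ℝ (fun n => f (n + 1)) x‖ ≤ M * jamesNorm x := by
  obtain ⟨n, hn⟩ := x.support.exists_nat_subset_range
  have h := hf n fun i => x (i - 1)
  have h₁ : (fun j => if j < n then x (j + 1 - 1) else 0) = x := by
    ext j
    split_ifs with hj
    · simp
    · by_contra hne
      exact hj (Finset.mem_range.1 (hn (Finsupp.mem_support_iff.2 (Ne.symm hne))))
  have h₂ : ∑ i ∈ Finset.Icc 1 n, x (i - 1) • f i =
      Finsupp.linearCombination ℝ (fun n => f (n + 1)) x := by
    rw [linearCombination_eq_sum_range _ x hn, Finset.range_eq_Ico]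
    exact (Finset.sum_Ico_add' (fun i => x (i - 1) • f i) 0 n 1).symm
  rwa [h₁, h₂] at h

lemma norm_linearCombination_le_gMap (f : ℕ → C(I, ℝ)) (x : ℕ →₀ ℝ) :
    ‖Finsupp.linearCombination ℝ (fun n => f (n + 1)) x‖ ≤
      ‖Finsupp.linearCombination ℝ (fun n => gMap f (n + 1)) x‖ := by
  refine (ContinuousMap.norm_le _ (norm_nonneg _)).2 fun a => ?_
  refine le_trans (le_of_eq ?_)
    ((Finsupp.linearCombination ℝ (fun n => gMap f (n + 1)) x).norm_coe_le_norm (a, 0))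
  simp [Finsupp.linearCombination_apply, Finsupp.sum, ContinuousMap.sum_apply, gMap]

lemma norm_linearCombination_gMap_le {M : ℝ} (hM : 0 < M) {f : ℕ → C(I, ℝ)}
    (hup : ∀ x : ℕ →₀ ℝ,
      ‖Finsupp.linearCombination ℝ (fun n => f (n + 1)) x‖ ≤ M * jamesNorm x) (x : ℕ →₀ ℝ) :
    ‖Finsupp.linearCombination ℝ (fun n => gMap f (n + 1)) x‖ ≤ M * jamesNorm x := by
  refine (ContinuousMap.norm_le _ (mul_nonneg hM.le (jamesNorm_nonneg _))).2 fun ⟨a, b⟩ => ?_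
  obtain ⟨n, hn⟩ := x.support.exists_nat_subset_range
  rw [linearCombination_eq_sum_range _ x hn, ContinuousMap.sum_apply, Real.norm_eq_abs]
  have h := abs_sum_mul_le_of_antitone (a := fun i => x i * f (i + 1) a)
    (h := fun i => max 0 (1 - 2 ^ (i + 1) * (b : ℝ))) (B := M * jamesNorm x) ?_
    (fun i => le_max_left _ _) ?_ ?_ n
  · refine le_of_eq_of_le (congrArg _ (Finset.sum_congr rfl fun i _ => ?_)) h
    simp only [ContinuousMap.smul_apply, gMap, ContinuousMap.coe_mk, smul_eq_mul]
    ring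
  · intro i j hij
    have hb : (0 : ℝ) ≤ b := b.2.1
    refine max_le_max le_rfl (sub_le_sub_left (mul_le_mul_of_nonneg_right ?_ hb) 1)
    exact pow_le_pow_right₀ (by norm_num) (by omega)
  · have hb : (0 : ℝ) ≤ b := b.2.1
    exact max_le zero_le_one (by simpa using hb)
  · intro m
    have h₁ := ((ContinuousMap.norm_coe_le_norm _ a).trans (hup (x.filter (· < m)))).trans
      (mul_le_mul_of_nonneg_left (jamesNorm_filter_lt_le x m) hM.le)
    rw [linearCombination_eq_sum_range _ _ (n := m) fun i hi => ?_, ContinuousMap.sum_apply,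
      Real.norm_eq_abs] at h₁
    · refine le_of_eq_of_le (congrArg _ (Finset.sum_congr rfl fun i hi => ?_)) h₁
      simp [Finset.mem_range.1 hi]
    · rw [Finsupp.support_filter, Finset.mem_filter] at hi
      exact Finset.mem_range.2 hi.2

/-- Let `M > 0` and `(f_n)` be a sequence of continuous real-valued functions on `[0,1]`
such that `(1/M)·‖(λ_1,…,λ_n,0,…)‖_J ≤ ‖λ_1 f_1 + ⋯ + λ_n f_n‖_∞ ≤ M·‖(λ_1,…,λ_n,0,…)‖_J`
for every `n` and all reals `λ_1, …, λ_n`.  With `g_n(a,b) = f_n(a)·max(0, 1 − 2ⁿ b)` on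
`K = [0,1]²`, there is no isomorphic embedding of `c₀` (here `C₀(ℕ, ℝ)`, the real sequences
tending to `0` with the supremum norm) into the closed linear span of `{g_n : n ≥ 1}` in
`C(K)`: no continuous linear injection from `c₀` into that closed linear span is bounded
below. -/
theorem no_c0_embedding_into_closed_span_gMap (M : ℝ) (hM : 0 < M) (f : ℕ → C(I, ℝ))
    (hf : ∀ (n : ℕ) (lam : ℕ → ℝ),
      (1 / M) * jamesNorm (fun j => if j < n then lam (j + 1) else 0) ≤
        ‖∑ i ∈ Finset.Icc 1 n, lam i • f i‖ ∧
      ‖∑ i ∈ Finset.Icc 1 n, lam i • f i‖ ≤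
        M * jamesNorm (fun j => if j < n then lam (j + 1) else 0)) :
    ¬ ∃ T : C₀(ℕ, ℝ) →L[ℝ]
        (Submodule.span ℝ (Set.range fun n => gMap f (n + 1))).topologicalClosure,
      Function.Injective T ∧ ∃ c : ℝ, 0 < c ∧ ∀ x, c * ‖x‖ ≤ ‖T x‖ := by
  rintro ⟨T, -, c, hc, hT⟩
  set G := Finsupp.linearCombination ℝ (fun n => gMap f (n + 1)) with hG
  have hlow : ∀ x : ℕ →₀ ℝ, jamesNorm x ≤ M * ‖G x‖ := fun x => by
    have h := (jamesNorm_equiv_linearCombination hf x).1.trans (norm_linearCombination_le_gMap f x)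
    rwa [one_div, inv_mul_le_iff₀ hM] at h
  have hup := norm_linearCombination_gMap_le hM fun x => (jamesNorm_equiv_linearCombination hf x).2
  obtain ⟨δ, hδ, hTδ⟩ := Metric.continuous_iff.1 T.continuous 0 1 one_pos
  have hbound : ∀ x : C₀(ℕ, ℝ), ‖x‖ ≤ 1 → ‖(T x : C(I × I, ℝ))‖ ≤ 2 / δ := fun x hx => by
    have h₁ : ‖(δ / 2) • x‖ < δ := by
      rw [norm_smul, Real.norm_of_nonneg (by positivity)]
      nlinarith
    have h₂ := hTδ ((δ / 2) • x) (by rwa [dist_zero_right])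
    rw [map_zero, map_smul, Subtype.dist_eq, Submodule.coe_zero, dist_zero_right, Submodule.coe_smul,
      norm_smul, Real.norm_of_nonneg (by positivity)] at h₂
    rw [le_div_iff₀ hδ]
    linarith
  refine not_bounded_signed_sums_of_mem_closure G hM hlow hup
    (fun k => (T (c0Single k) : C(I × I, ℝ))) (fun k => ?_) hc (fun k => ?_) (C := 2 / δ) fun S s hs => ?_
  · have h := (T (c0Single k)).2
    rw [← SetLike.mem_coe, Submodule.topologicalClosure_coe] at h
    rwa [hG, ← LinearMap.coe_range, Finsupp.range_linearCombination]
  · exact (le_mul_of_one_le_right hc.le (norm_c0Single_ge k)).trans (hT _)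
  · have h := hbound _ (norm_sum_smul_c0Single_le S s hs)
    rw [map_sum] at h
    simpa only [map_smul, Submodule.coe_norm, Submodule.coe_sum, Submodule.coe_smul] using h
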